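/- (Theorem 1.1(i), N = 2.) For every r ≥ 1 and all ε₁,…,ε_r ∈ {1,−1} with ε_r = −1, there exists a rational number c such that ζ(1,…,1; ε₁,…,ε_r) − c · ζ(1,…,1; 1,…,1,−1) lies in D_{r−1} Z_r(2). In other words, the depth-graded space of unit cyclotomic multiple zeta values of weight r for μ₂ is spanned by the image of ζ(1,…,1; 1,…,1,−1). -/

import Mathlib

open Filter Topology

/-- Partial sum of the series defining a cyclotomic multiple zeta value. -/
noncomputable def cmzvPartial (r : ℕ) (k : Fin r → ℕ) (ε : Fin r → ℂ) (M : ℕ) : ℂ :=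
  ∑ n ∈ (Fintype.piFinset fun _ : Fin r => Finset.Icc 1 M).filter
      (fun n => ∀ i j : Fin r, i < j → n i < n j),
    ∏ i, ε i ^ n i / (n i : ℂ) ^ k i

/-- `z` is a cyclotomic multiple zeta value for `μ_N` of weight `K` and depth `d`. -/
def IsCMZV (N K d : ℕ) (z : ℂ) : Prop :=
  ∃ _hd : 1 ≤ d, ∃ (k : Fin d → ℕ) (ε : Fin d → ℂ),
    (∀ i, 1 ≤ k i) ∧ (∀ i, ε i ^ N = 1) ∧
    ¬(k ⟨d - 1, by omega⟩ = 1 ∧ ε ⟨d - 1, by omega⟩ = 1) ∧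
    (∑ i, k i) = K ∧
    Tendsto (cmzvPartial d k ε) atTop (𝓝 z)

/-- `D_s Z_K(N)`: the `ℚ`-span of cyclotomic multiple zeta values for `μ_N` of weight `K`
and depth at most `s`. -/
noncomputable def depthFilteredCMZV (N K s : ℕ) : Submodule ℚ ℂ :=
  Submodule.span ℚ {z : ℂ | ∃ d ≤ s, IsCMZV N K d z}

namespace UnitCMZV

/-- The sequence `1, 0, 0, …`. -/
noncomputable def dl : ℕ → ℝ := fun n => if n = 0 then 1 else 0

/-- The power series with coefficients `c`. -/
noncomputable def PS (c : ℕ → ℝ) (t : ℝ) : ℝ := ∑' n, c n * t ^ n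

noncomputable def Bop (c : ℕ → ℝ) : ℕ → ℝ := fun n => (∑ m ∈ Finset.range n, c m) / n

noncomputable def Eop (c : ℕ → ℝ) : ℕ → ℝ := fun n => c n / n

noncomputable def Fop (η : ℝ) (c : ℕ → ℝ) : ℕ → ℝ :=
  fun n => (η ^ n * ∑ m ∈ Finset.range n, η ^ m * c m) / n

def Decay (c : ℕ → ℝ) : Prop := ∃ C : ℝ, 0 ≤ C ∧ ∀ n : ℕ, |c n| ≤ C / √((n : ℝ) + 1)

lemma decay_dl : Decay dl := by
  refine ⟨1, zero_le_one, fun n => ?_⟩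
  rcases Nat.eq_zero_or_pos n with h | h
  · subst h; simp [dl]
  · simp only [dl, if_neg h.ne']; simp

lemma decay_add {c d : ℕ → ℝ} (hc : Decay c) (hd : Decay d) : Decay (c + d) := by
  obtain ⟨C, hC, h1⟩ := hc
  obtain ⟨D, hD, h2⟩ := hd
  refine ⟨C + D, by positivity, fun n => ?_⟩
  rw [add_div]
  exact (abs_add_le _ _).trans (add_le_add (h1 n) (h2 n))

lemma sum_sqrt (n : ℕ) : ∑ m ∈ Finset.range n, 1 / √((m : ℝ) + 1) ≤ 2 * √(n : ℝ) := by
  induction n with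
  | zero => simp
  | succ n ih =>
    rw [Finset.sum_range_succ]
    have hb : 0 < √((n : ℝ) + 1) := by positivity
    have hb2 : √((n : ℝ) + 1) ^ 2 = (n : ℝ) + 1 := Real.sq_sqrt (by positivity)
    have ha2 : √(n : ℝ) ^ 2 = (n : ℝ) := Real.sq_sqrt (by positivity)
    push_cast
    have : 1 / √((n : ℝ) + 1) ≤ 2 * √((n : ℝ) + 1) - 2 * √(n : ℝ) := by
      rw [div_le_iff₀ hb]
      nlinarith [sq_nonneg (√((n : ℝ) + 1) - √(n : ℝ))]
    linarith

lemma decay_avg {c d : ℕ → ℝ} (hc : Decay c)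
    (h : ∀ n, |d n| ≤ (∑ m ∈ Finset.range n, |c m|) / n) : Decay d := by
  obtain ⟨C, hC, h1⟩ := hc
  refine ⟨4 * C, by positivity, fun n => (h n).trans ?_⟩
  rcases Nat.eq_zero_or_pos n with h0 | h0
  · subst h0; simp; positivity
  have hn : (1 : ℝ) ≤ n := by exact_mod_cast h0
  have h2 : ∑ m ∈ Finset.range n, |c m| ≤ C * (2 * √(n : ℝ)) := by
    calc _ ≤ ∑ m ∈ Finset.range n, C * (1 / √((m : ℝ) + 1)) := by
          apply Finset.sum_le_sum
          intro m _
          rw [mul_one_div]; exact h1 m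
      _ ≤ _ := by
          rw [← Finset.mul_sum]
          exact mul_le_mul_of_nonneg_left (sum_sqrt n) hC
  have hb : 0 < √((n : ℝ) + 1) := by positivity
  have ha : 0 < √(n : ℝ) := by positivity
  have ha2 : √(n : ℝ) ^ 2 = (n : ℝ) := Real.sq_sqrt (by positivity)
  have hba : √((n : ℝ) + 1) ≤ 2 * √(n : ℝ) := by
    rw [Real.sqrt_le_left (by positivity)]
    nlinarith
  calc _ ≤ C * (2 * √(n : ℝ)) / n := by gcongr
    _ ≤ _ := by
      rw [div_le_div_iff₀ (by positivity) hb]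
      nlinarith [mul_le_mul_of_nonneg_left hba (mul_nonneg hC ha.le)]

lemma decay_Bop {c : ℕ → ℝ} (hc : Decay c) : Decay (Bop c) := by
  refine decay_avg hc fun n => ?_
  rw [Bop, abs_div, Nat.abs_cast]
  gcongr
  exact Finset.abs_sum_le_sum_abs _ _

lemma decay_Fop {η : ℝ} (hη : η = 1 ∨ η = -1) {c : ℕ → ℝ} (hc : Decay c) : Decay (Fop η c) := by
  have hp : ∀ n : ℕ, |η ^ n| = 1 := by
    intro n; rcases hη with rfl | rfl <;> simp
  refine decay_avg hc fun n => ?_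
  rw [Fop, abs_div, Nat.abs_cast, abs_mul, hp, one_mul]
  gcongr
  refine (Finset.abs_sum_le_sum_abs _ _).trans (le_of_eq ?_)
  refine Finset.sum_congr rfl fun m _ => ?_
  rw [abs_mul, hp, one_mul]

lemma decay_of_abs_le {c d : ℕ → ℝ} (hc : Decay c) (h : ∀ n, |d n| ≤ |c n|) : Decay d := by
  obtain ⟨C, hC, h1⟩ := hc
  exact ⟨C, hC, fun n => (h n).trans (h1 n)⟩

lemma decay_Eop {c : ℕ → ℝ} (hc : Decay c) : Decay (Eop c) := by
  refine decay_of_abs_le hc fun n => ?_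
  rw [Eop, abs_div, Nat.abs_cast]
  rcases Nat.eq_zero_or_pos n with h0 | h0
  · subst h0; simp
  · exact div_le_self (abs_nonneg _) (by exact_mod_cast h0)

lemma decay_tendsto {c : ℕ → ℝ} (hc : Decay c) : Tendsto c atTop (𝓝 0) := by
  obtain ⟨C, hC, h1⟩ := hc
  refine squeeze_zero_norm h1 ?_
  refine Tendsto.div_atTop tendsto_const_nhds ?_
  exact Real.tendsto_sqrt_atTop.comp
    (tendsto_atTop_add_const_right _ _ tendsto_natCast_atTop_atTop)

lemma decay_bdd {c : ℕ → ℝ} (hc : Decay c) : ∃ C : ℝ, 0 ≤ C ∧ ∀ n, |c n| ≤ C := by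
  obtain ⟨C, hC, h1⟩ := hc
  refine ⟨C, hC, fun n => (h1 n).trans (div_le_self hC ?_)⟩
  rw [Real.one_le_sqrt]; linarith [(Nat.cast_nonneg n : (0 : ℝ) ≤ n)]

lemma decay_summable {c : ℕ → ℝ} (hc : Decay c) :
    Summable fun n : ℕ => |c n| / ((n : ℝ) + 1) := by
  obtain ⟨C, hC, h1⟩ := hc
  have h2 : Summable fun n : ℕ => C * (1 / ((n + 1 : ℕ) : ℝ) ^ (3 / 2 : ℝ)) := by
    refine Summable.mul_left _ ?_
    exact (summable_nat_add_iff (f := fun n : ℕ => 1 / (n : ℝ) ^ (3 / 2 : ℝ)) 1).2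
      (Real.summable_one_div_nat_rpow.2 (by norm_num))
  refine Summable.of_nonneg_of_le (fun n => by positivity) (fun n => ?_) h2
  have hn : (0 : ℝ) < (n : ℝ) + 1 := by positivity
  have : ((n : ℝ) + 1) ^ (3 / 2 : ℝ) = √((n : ℝ) + 1) * ((n : ℝ) + 1) := by
    rw [Real.sqrt_eq_rpow, ← Real.rpow_add_one hn.ne']; norm_num
  push_cast
  rw [this, mul_one_div, ← div_div]
  gcongr
  exact h1 n

/-- Convergence of partial sums. -/
def SumsTo (c : ℕ → ℝ) (v : ℝ) : Prop :=
  Tendsto (fun N => ∑ n ∈ Finset.range N, c n) atTop (𝓝 v)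

lemma SumsTo.add {c d : ℕ → ℝ} {v w : ℝ} (hc : SumsTo c v) (hd : SumsTo d w) :
    SumsTo (c + d) (v + w) := by
  have := Tendsto.add hc hd
  refine this.congr fun N => ?_
  simp [Finset.sum_add_distrib]

lemma conv_Bop {e : ℕ → ℝ} (he : Decay e) : ∃ v, SumsTo (fun n => (-1) ^ n * Bop e n) v := by
  set d := Bop e with hd
  have hdd : Decay d := decay_Bop he
  have hdiff : ∀ n : ℕ, d n - d (n + 1) = (d n - e n) / ((n : ℝ) + 1) := by
    intro n
    rw [hd]
    simp only [Bop, Finset.sum_range_succ]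
    rcases Nat.eq_zero_or_pos n with h0 | h0
    · subst h0; simp
    · have : (n : ℝ) ≠ 0 := by positivity
      have h3 : (n : ℝ) + 1 ≠ 0 := by positivity
      push_cast
      field_simp
      ring
  have hs : Summable fun n : ℕ => (-1 : ℝ) ^ n * (d n - d (n + 1)) := by
    refine Summable.of_norm_bounded ((decay_summable hdd).add (decay_summable he)) fun n => ?_
    rw [hdiff, norm_mul, norm_pow, norm_neg, norm_one, one_pow, one_mul, Real.norm_eq_abs, abs_div,
      ← add_div, abs_of_nonneg (by positivity : (0 : ℝ) ≤ (n : ℝ) + 1)]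
    gcongr
    exact abs_sub _ _
  obtain ⟨S, hS⟩ := hs
  have hS' := hS.tendsto_sum_nat
  have key : ∀ N : ℕ, ∑ n ∈ Finset.range N, (-1 : ℝ) ^ n * d n =
      (∑ n ∈ Finset.range N, (-1 : ℝ) ^ n * (d n - d (n + 1)) + d 0 - (-1) ^ N * d N) / 2 := by
    intro N
    induction N with
    | zero => simp
    | succ N ih =>
      rw [Finset.sum_range_succ, Finset.sum_range_succ, ih, pow_succ]
      ring
  have h0 : Tendsto (fun N : ℕ => (-1 : ℝ) ^ N * d N) atTop (𝓝 0) := by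
    refine squeeze_zero_norm (fun N => ?_) (by simpa using (decay_tendsto hdd).norm)
    simp
  refine ⟨(S + d 0 - 0) / 2, ?_⟩
  refine Tendsto.congr (fun N => (key N).symm) ?_
  exact ((hS'.add_const _).sub h0).div_const 2

lemma conv_Eop {e : ℕ → ℝ} (he : Decay e) : ∃ v, SumsTo (Eop e) v := by
  have : Summable (Eop e) := by
    refine Summable.of_norm_bounded ((decay_summable he).mul_left 2) fun n => ?_
    rw [Eop, Real.norm_eq_abs, abs_div, Nat.abs_cast]
    rcases Nat.eq_zero_or_pos n with h0 | h0
    · subst h0; simp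
    have hn : (1 : ℝ) ≤ n := by exact_mod_cast h0
    rw [← mul_div_assoc, div_le_div_iff₀ (by positivity) (by positivity)]
    nlinarith [mul_nonneg (abs_nonneg (e n)) (sub_nonneg.2 hn)]
  obtain ⟨v, hv⟩ := this
  exact ⟨v, hv.tendsto_sum_nat⟩

lemma decay_tw {e : ℕ → ℝ} (he : Decay e) : Decay (fun n => (-1) ^ n * e n) :=
  decay_of_abs_le he fun n => by simp [abs_mul]

lemma Fop_neg (e : ℕ → ℝ) (n : ℕ) :
    Fop (-1) e n = (-1) ^ n * Bop (fun n => (-1) ^ n * e n) n := by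
  simp only [Fop, Bop, mul_div_assoc]

lemma conv_Fop {e : ℕ → ℝ} (he : Decay e) : ∃ v, SumsTo (Fop (-1) e) v := by
  obtain ⟨v, hv⟩ := conv_Bop (decay_tw he)
  refine ⟨v, ?_⟩
  have : Fop (-1) e = _ := funext (Fop_neg e)
  rw [this]; exact hv

lemma PS_summable {c : ℕ → ℝ} (hc : Decay c) {t : ℝ} (ht : |t| < 1) :
    Summable fun n => c n * t ^ n := by
  obtain ⟨C, hC, h⟩ := decay_bdd hc
  refine Summable.of_norm_bounded
    ((summable_geometric_of_lt_one (abs_nonneg t) ht).mul_left C) fun n => ?_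
  rw [norm_mul, norm_pow, Real.norm_eq_abs, Real.norm_eq_abs]
  gcongr
  exact h n

lemma PS_hasDeriv {c : ℕ → ℝ} (hc : Decay c) {t : ℝ} (ht : |t| < 1) :
    Summable (fun n : ℕ => ((n : ℝ) + 1) * c (n + 1) * t ^ n) ∧
    HasDerivAt (PS c) (∑' n : ℕ, ((n : ℝ) + 1) * c (n + 1) * t ^ n) t := by
  obtain ⟨C, hC, h⟩ := decay_bdd hc
  obtain ⟨ρ, h1, h2⟩ := exists_between ht
  have hρ : 0 < ρ := (abs_nonneg t).trans_lt h1
  have hu0 : Summable fun n : ℕ => C * (((n : ℝ) + 1) * ρ ^ n) := by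
    refine Summable.mul_left _ ?_
    have e1 := summable_pow_mul_geometric_of_norm_lt_one 1 (r := ρ)
      (by rw [Real.norm_eq_abs, abs_of_pos hρ]; exact h2)
    have e2 := summable_geometric_of_lt_one hρ.le h2
    refine (e1.add e2).congr fun n => ?_
    ring
  have hu : Summable fun n : ℕ => C * ((n : ℝ) * ρ ^ (n - 1)) := by
    rw [← summable_nat_add_iff 1]
    simpa using hu0
  have hb : ∀ (n : ℕ) (y : ℝ), y ∈ Metric.ball (0 : ℝ) ρ →
      ‖c n * ((n : ℝ) * y ^ (n - 1))‖ ≤ C * ((n : ℝ) * ρ ^ (n - 1)) := by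
    intro n y hy
    rw [mem_ball_zero_iff] at hy
    rw [norm_mul, norm_mul, norm_pow, Real.norm_eq_abs, Real.norm_natCast]
    gcongr
    exact h n
  have htm : t ∈ Metric.ball (0 : ℝ) ρ := by rw [mem_ball_zero_iff]; exact h1
  have hs : Summable fun n : ℕ => c n * ((n : ℝ) * t ^ (n - 1)) :=
    Summable.of_norm_bounded hu fun n => hb n t htm
  have hd := hasDerivAt_tsum_of_isPreconnected (g := fun n y => c n * y ^ n)
    (g' := fun n y => c n * ((n : ℝ) * y ^ (n - 1))) hu Metric.isOpen_ball
    (convex_ball (0 : ℝ) ρ).isPreconnected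
    (fun n y _ => (hasDerivAt_pow n y).const_mul (c n)) hb htm (PS_summable hc ht) htm
  have e : ∀ n : ℕ, c (n + 1) * (((n + 1 : ℕ) : ℝ) * t ^ (n + 1 - 1)) =
      ((n : ℝ) + 1) * c (n + 1) * t ^ n := by
    intro n; push_cast; ring
  constructor
  · exact ((summable_nat_add_iff 1).2 hs).congr e
  · rw [hs.tsum_eq_zero_add] at hd
    simp only [e] at hd
    simpa [PS] using! hd

lemma PS_shift {c : ℕ → ℝ} (hc : Decay c) {t : ℝ} (ht : |t| < 1) :
    PS c t = c 0 + t * ∑' n, c (n + 1) * t ^ n := by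
  rw [PS, (PS_summable hc ht).tsum_eq_zero_add, ← tsum_mul_left]
  simp only [pow_zero, mul_one, pow_succ]
  congr 1
  exact tsum_congr fun n => by ring

lemma PS_Eop {c : ℕ → ℝ} (hc : Decay c) (h0 : c 0 = 0) {t : ℝ} (ht : |t| < 1) (ht0 : t ≠ 0) :
    HasDerivAt (PS (Eop c)) (PS c t / t) t := by
  have h := (PS_hasDeriv (decay_Eop hc) ht).2
  convert h using 1
  rw [PS_shift hc ht, h0, zero_add, mul_div_cancel_left₀ _ ht0]
  refine tsum_congr fun n => ?_
  have : (n : ℝ) + 1 ≠ 0 := by positivity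
  simp only [Eop]
  push_cast
  field_simp

lemma PS_Fop {η : ℝ} (hη : η = 1 ∨ η = -1) {c : ℕ → ℝ} (hc : Decay c) {t : ℝ} (ht : |t| < 1) :
    HasDerivAt (PS (Fop η c)) (η / (1 - η * t) * PS c t) t := by
  obtain ⟨hs, h⟩ := PS_hasDeriv (decay_Fop hη hc) ht
  convert h using 1
  have hηη : η * η = 1 := by rcases hη with rfl | rfl <;> norm_num
  have hne : 1 - η * t ≠ 0 := by
    have := abs_lt.1 ht
    rcases hη with rfl | rfl <;> intro h <;> linarith
  set a : ℕ → ℝ := fun n => ((n : ℝ) + 1) * Fop η c (n + 1) with ha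
  have ha0 : a 0 = η * c 0 := by simp [ha, Fop]
  have hpp : ∀ n : ℕ, η ^ n * η ^ n = 1 := fun n => by rw [← mul_pow, hηη, one_pow]
  have haS : ∀ n : ℕ, a (n + 1) = η * a n + η * c (n + 1) := by
    intro n
    have e1 : (n : ℝ) + 1 ≠ 0 := by positivity
    have e2 : (n : ℝ) + 1 + 1 ≠ 0 := by positivity
    simp only [ha, Fop]
    rw [Finset.sum_range_succ _ (n + 1)]
    push_cast
    rw [mul_div_cancel₀ _ e2, mul_div_cancel₀ _ e1, mul_add, pow_succ η (n + 1)]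
    linear_combination (η * c (n + 1)) * hpp (n + 1)
  have hs' : Summable fun n => a n * t ^ n := hs
  have hcs := PS_summable hc ht
  have hcs1 : Summable fun n => c (n + 1) * t ^ n := by
    by_cases h0 : t = 0
    · subst h0
      refine summable_of_ne_finset_zero (s := {0}) fun n hn => ?_
      simp at hn; simp [hn]
    · have := ((summable_nat_add_iff 1).2 hcs).mul_left t⁻¹
      refine this.congr fun n => ?_
      rw [pow_succ]; field_simp
  have hA : ∑' n, a n * t ^ n = η * t * (∑' n, a n * t ^ n) + η * PS c t := by
    conv_lhs => rw [hs'.tsum_eq_zero_add]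
    rw [PS_shift hc ht]
    have : ∀ n, a (n + 1) * t ^ (n + 1) =
        (η * t) * (a n * t ^ n) + (η * t) * (c (n + 1) * t ^ n) := by
      intro n; rw [haS, pow_succ]; ring
    simp only [this]
    rw [(hs'.mul_left _).tsum_add (hcs1.mul_left _), tsum_mul_left, tsum_mul_left, ha0]
    ring
  change _ = ∑' n, a n * t ^ n
  rw [div_mul_eq_mul_div, div_eq_iff hne]
  linarith

lemma PS_cont {c : ℕ → ℝ} (hc : Decay c) {t : ℝ} (ht : |t| < 1) : ContinuousAt (PS c) t :=
  (PS_hasDeriv hc ht).2.continuousAt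

lemma PS_zero {c : ℕ → ℝ} : PS c 0 = c 0 := by
  rw [PS, tsum_eq_single 0]
  · simp
  · intro n hn; simp [hn]

lemma PS_dl (t : ℝ) : PS dl t = 1 := by
  rw [PS, tsum_eq_single 0]
  · simp [dl]
  · intro n hn; simp [dl, hn]

lemma PS_abel {c : ℕ → ℝ} {v : ℝ} (h : SumsTo c v) : Tendsto (PS c) (𝓝[<] 1) (𝓝 v) :=
  Real.tendsto_tsum_powerSeries_nhdsWithin_lt h

lemma ev_Ioo : ∀ᶠ t : ℝ in 𝓝[<] 1, 0 < t ∧ t < 1 :=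
  Ioo_mem_nhdsLT (zero_lt_one)

lemma PS_small {c : ℕ → ℝ} (hc : Decay c) :
    Tendsto (fun t => (1 - t) * PS c t) (𝓝[<] 1) (𝓝 0) := by
  set g : ℕ → ℝ := fun n => c n - (if n = 0 then 0 else c (n - 1)) with hg
  have hsum : ∀ N, ∑ n ∈ Finset.range (N + 1), g n = c N := by
    intro N
    induction N with
    | zero => simp [hg]
    | succ N ih => rw [Finset.sum_range_succ, ih]; simp [hg]
  have h1 : SumsTo g 0 := by
    rw [SumsTo, ← tendsto_add_atTop_iff_nat 1]
    simp only [hsum]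
    exact decay_tendsto hc
  refine (PS_abel h1).congr' ?_
  filter_upwards [ev_Ioo] with t ht
  have ht' : |t| < 1 := abs_lt.2 ⟨by linarith, ht.2⟩
  have hs := PS_summable hc ht'
  have hs1 : Summable fun n => (if n = 0 then 0 else c (n - 1)) * t ^ n := by
    rw [← summable_nat_add_iff 1]
    refine (hs.mul_left t).congr fun n => ?_
    simp [pow_succ]; ring
  have e : ∑' n, (if n = 0 then 0 else c (n - 1)) * t ^ n = t * PS c t := by
    rw [hs1.tsum_eq_zero_add, PS, ← tsum_mul_left]
    simp only [if_true, zero_mul, zero_add]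
    refine tsum_congr fun n => ?_
    simp [pow_succ]; ring
  have : PS g t = PS c t - t * PS c t := by
    rw [← e, PS, PS, ← hs.tsum_sub hs1]
    exact tsum_congr fun n => by simp only [hg]; ring
  rw [this]; ring

/-- Coefficients of the iterated integrals on the `t` side. -/
noncomputable def Fs : List ℝ → ℕ → ℝ
  | [] => dl
  | η :: w => Fop η (Fs w)

/-- The operator on coefficients for the `s = (1 - t) / (1 + t)` side. -/
noncomputable def Gop (η : ℝ) (g : ℕ → ℝ) : ℕ → ℝ :=
  if η = 1 then Eop g + Fop (-1) g else Fop (-1) g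

noncomputable def Gops : List ℝ → (ℕ → ℝ) → ℕ → ℝ
  | [], g => g
  | η :: w, g => Gops w (Gop η g)

noncomputable def Hf : List ℝ → (ℕ → ℝ) → ℝ → ℝ
  | [], g, t => PS g ((1 - t) / (1 + t))
  | η :: w, g, t => PS g ((1 - t) / (1 + t)) * PS (Fs (η :: w)) t + Hf w (Gop η g) t

def Signs (w : List ℝ) : Prop := ∀ η ∈ w, η = 1 ∨ η = -1

lemma decay_Fs {w : List ℝ} (hw : Signs w) : Decay (Fs w) := by
  induction w with
  | nil => exact decay_dl
  | cons η w ih =>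
    exact decay_Fop (hw η (by simp)) (ih fun x hx => hw x (by simp [hx]))

lemma decay_Gop (η : ℝ) {g : ℕ → ℝ} (hg : Decay g) : Decay (Gop η g) := by
  rw [Gop]
  split_ifs
  · exact decay_add (decay_Eop hg) (decay_Fop (Or.inr rfl) hg)
  · exact decay_Fop (Or.inr rfl) hg

lemma Gop_zero (η : ℝ) (g : ℕ → ℝ) : Gop η g 0 = 0 := by
  rw [Gop]
  split_ifs <;> simp [Eop, Fop]

lemma conv_Gop (η : ℝ) {g : ℕ → ℝ} (hg : Decay g) : ∃ v, SumsTo (Gop η g) v := by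
  rw [Gop]
  obtain ⟨v, hv⟩ := conv_Fop hg
  obtain ⟨u, hu⟩ := conv_Eop hg
  split_ifs
  · exact ⟨_, hu.add hv⟩
  · exact ⟨v, hv⟩

lemma conv_Gops (w : List ℝ) {g : ℕ → ℝ} (hg : Decay g) (h : ∃ v, SumsTo g v) :
    ∃ v, SumsTo (Gops w g) v := by
  induction w generalizing g with
  | nil => exact h
  | cons η w ih => exact ih (decay_Gop η hg) (conv_Gop η hg)

lemma s_pos {t : ℝ} (h0 : 0 < t) (h1 : t < 1) :
    0 < (1 - t) / (1 + t) ∧ |(1 - t) / (1 + t)| < 1 := by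
  have hp : 0 < (1 - t) / (1 + t) := div_pos (by linarith) (by linarith)
  refine ⟨hp, ?_⟩
  rw [abs_of_pos hp, div_lt_one (by linarith)]
  linarith

lemma s_deriv {t : ℝ} (h0 : 0 < t) :
    HasDerivAt (fun t : ℝ => (1 - t) / (1 + t)) (-2 / (1 + t) ^ 2) t := by
  have h := ((hasDerivAt_id t).const_sub 1).div ((hasDerivAt_id t).const_add 1)
    (by simp only [id]; linarith : 1 + id t ≠ 0)
  refine h.congr_deriv ?_
  simp only [id]
  congr 1
  ring

lemma Fneg_deriv {g : ℕ → ℝ} (hg : Decay g) {t : ℝ} (h0 : 0 < t) (h1 : t < 1) :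
    HasDerivAt (fun t => PS (Fop (-1) g) ((1 - t) / (1 + t)))
      (1 / (1 + t) * PS g ((1 - t) / (1 + t))) t := by
  obtain ⟨hp, ha⟩ := s_pos h0 h1
  have h := (PS_Fop (η := -1) (Or.inr rfl) hg ha).comp t (s_deriv h0)
  refine h.congr_deriv ?_
  have e1 : 1 + t ≠ 0 := by linarith
  have e2 : 1 - -1 * ((1 - t) / (1 + t)) = 2 / (1 + t) := by field_simp; ring
  rw [e2]
  field_simp

lemma E_deriv {g : ℕ → ℝ} (hg : Decay g) (hg0 : g 0 = 0) {t : ℝ} (h0 : 0 < t) (h1 : t < 1) :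
    HasDerivAt (fun t => PS (Eop g) ((1 - t) / (1 + t)))
      (-(1 / (1 + t) + 1 / (1 - t)) * PS g ((1 - t) / (1 + t))) t := by
  obtain ⟨hp, ha⟩ := s_pos h0 h1
  have h := (PS_Eop hg hg0 ha hp.ne').comp t (s_deriv h0)
  refine h.congr_deriv ?_
  have e1 : 1 + t ≠ 0 := by linarith
  have e2 : 1 - t ≠ 0 := by linarith
  field_simp
  ring

lemma PS_add {c d : ℕ → ℝ} (hc : Decay c) (hd : Decay d) {t : ℝ} (ht : |t| < 1) :
    PS (c + d) t = PS c t + PS d t := by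
  simp only [PS, Pi.add_apply, add_mul]
  exact (PS_summable hc ht).tsum_add (PS_summable hd ht)

lemma Gop_deriv {η : ℝ} (hη : η = 1 ∨ η = -1) {g : ℕ → ℝ} (hg : Decay g) (hg0 : g 0 = 0)
    {t : ℝ} (h0 : 0 < t) (h1 : t < 1) :
    HasDerivAt (fun t => PS (Gop η g) ((1 - t) / (1 + t)))
      (-(η / (1 - η * t)) * PS g ((1 - t) / (1 + t))) t := by
  rcases hη with rfl | rfl
  · have h := (E_deriv hg hg0 h0 h1).add (Fneg_deriv hg h0 h1)
    have h' := h.congr_of_eventuallyEq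
      (f₁ := fun t => PS (Gop 1 g) ((1 - t) / (1 + t))) (by
      filter_upwards [Ioo_mem_nhds h0 h1] with x hx
      rw [Gop, if_pos rfl, PS_add (decay_Eop hg) (decay_Fop (Or.inr rfl) hg) (s_pos hx.1 hx.2).2]
      rfl)
    refine h'.congr_deriv ?_
    ring
  · have h := Fneg_deriv hg h0 h1
    have e : Gop (-1) g = Fop (-1) g := by rw [Gop, if_neg (by norm_num)]
    rw [e]
    refine h.congr_deriv ?_
    congr 1
    rw [← neg_div, neg_neg]
    congr 1
    ring

lemma Hf_deriv {w : List ℝ} (hw : Signs w) {g : ℕ → ℝ} (hg : Decay g) (hg0 : g 0 = 0)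
    {t : ℝ} (h0 : 0 < t) (h1 : t < 1) {D : ℝ}
    (hD : HasDerivAt (fun t => PS g ((1 - t) / (1 + t))) D t) :
    HasDerivAt (Hf w g) (D * PS (Fs w) t) t := by
  induction w generalizing g D with
  | nil =>
    have e : PS (Fs []) t = 1 := PS_dl t
    rw [e, mul_one]
    exact hD
  | cons η w ih =>
    have hη := hw η (by simp)
    have hw' : Signs w := fun x hx => hw x (by simp [hx])
    have h2 := ih hw' (decay_Gop η hg) (Gop_zero η g) (Gop_deriv hη hg hg0 h0 h1)
    have ht : |t| < 1 := abs_lt.2 ⟨by linarith, h1⟩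
    have h3 := (hD.mul (PS_Fop hη (decay_Fs hw') ht)).add h2
    refine (h3.congr_deriv ?_)
    change _ = D * PS (Fop η (Fs w)) t
    ring

lemma tendsto_s0 : Tendsto (fun t : ℝ => (1 - t) / (1 + t)) (𝓝[>] 0) (𝓝[<] 1) := by
  refine tendsto_nhdsWithin_iff.2 ⟨?_, ?_⟩
  · have : ContinuousAt (fun t : ℝ => (1 - t) / (1 + t)) 0 := by
      refine ContinuousAt.div (by fun_prop) (by fun_prop) (by norm_num)
    have h := this.tendsto
    simp only [sub_zero, add_zero, div_one] at h
    exact h.mono_left nhdsWithin_le_nhds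
  · filter_upwards [self_mem_nhdsWithin] with t ht
    have ht' : (0 : ℝ) < t := ht
    change (1 - t) / (1 + t) < 1
    rw [div_lt_one (by linarith)]
    linarith

lemma tendsto_s1 : Tendsto (fun t : ℝ => (1 - t) / (1 + t)) (𝓝[<] 1) (𝓝 0) := by
  have : ContinuousAt (fun t : ℝ => (1 - t) / (1 + t)) 1 := by
    refine ContinuousAt.div (by fun_prop) (by fun_prop) (by norm_num)
  have h := this.tendsto
  simp only [sub_self, zero_div] at h
  exact h.mono_left nhdsWithin_le_nhds

lemma Fop_at0 (η : ℝ) (hη : η = 1 ∨ η = -1) {c : ℕ → ℝ} (hc : Decay c) :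
    Tendsto (PS (Fop η c)) (𝓝[>] 0) (𝓝 0) := by
  have h := (PS_cont (decay_Fop hη hc) (t := 0) (by simp)).tendsto
  have e : PS (Fop η c) 0 = 0 := by rw [PS_zero]; simp [Fop]
  rw [e] at h
  exact h.mono_left nhdsWithin_le_nhds

lemma Hf_at0 {w : List ℝ} (hw : Signs w) {g : ℕ → ℝ} (hg : Decay g) (hc : ∃ v, SumsTo g v)
    {v : ℝ} (hv : SumsTo (Gops w g) v) : Tendsto (Hf w g) (𝓝[>] 0) (𝓝 v) := by
  induction w generalizing g with
  | nil => exact (PS_abel hv).comp tendsto_s0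
  | cons η w ih =>
    have hη := hw η (by simp)
    have hw' : Signs w := fun x hx => hw x (by simp [hx])
    have h2 := ih hw' (decay_Gop η hg) (conv_Gop η hg) hv
    obtain ⟨u, hu⟩ := hc
    have h3 := (((PS_abel hu).comp tendsto_s0).mul (Fop_at0 η hη (decay_Fs hw'))).add h2
    rw [mul_zero, zero_add] at h3
    exact h3

lemma decay_shift {c : ℕ → ℝ} (hc : Decay c) : Decay (fun n => c (n + 1)) := by
  obtain ⟨C, hC, h⟩ := hc
  refine ⟨C, hC, fun n => (h (n + 1)).trans ?_⟩
  gcongr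
  linarith

lemma prod_at1 {g f : ℕ → ℝ} (hg : Decay g) (hg0 : g 0 = 0) (hf : Decay f) :
    Tendsto (fun t => PS g ((1 - t) / (1 + t)) * PS f t) (𝓝[<] 1) (𝓝 0) := by
  have h1 := PS_small hf
  have h2 : Tendsto (fun t : ℝ => PS (fun n => g (n + 1)) ((1 - t) / (1 + t))) (𝓝[<] 1)
      (𝓝 (PS (fun n => g (n + 1)) 0)) :=
    (PS_cont (decay_shift hg) (t := 0) (by simp)).tendsto.comp tendsto_s1
  have h3 : Tendsto (fun t : ℝ => 1 / (1 + t)) (𝓝[<] 1) (𝓝 (1 / (1 + 1))) := by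
    have : ContinuousAt (fun t : ℝ => 1 / (1 + t)) 1 :=
      ContinuousAt.div (by fun_prop) (by fun_prop) (by norm_num)
    exact this.tendsto.mono_left nhdsWithin_le_nhds
  have h4 := (h3.mul h2).mul h1
  rw [mul_zero] at h4
  refine h4.congr' ?_
  filter_upwards [ev_Ioo] with t ht
  rw [PS_shift hg (s_pos ht.1 ht.2).2, hg0, zero_add]
  simp only [PS]
  ring

lemma Hf_at1 {w : List ℝ} (hw : Signs w) {g : ℕ → ℝ} (hg : Decay g) (hg0 : g 0 = 0) :
    Tendsto (Hf w g) (𝓝[<] 1) (𝓝 0) := by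
  induction w generalizing g with
  | nil =>
    have h := (PS_cont hg (t := 0) (by simp)).tendsto.comp tendsto_s1
    rw [PS_zero, hg0] at h
    exact h
  | cons η w ih =>
    have hw' : Signs w := fun x hx => hw x (by simp [hx])
    have h2 := ih hw' (decay_Gop η hg) (Gop_zero η g)
    have h3 := (prod_at1 hg hg0 (decay_Fs hw)).add h2
    rw [zero_add] at h3
    exact h3

/-- The duality `t ↦ (1 - t) / (1 + t)` at the level of coefficient sequences. -/
theorem duality {w : List ℝ} (hw : Signs w) {v : ℝ} (hv : SumsTo (Fop (-1) (Fs w)) v) :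
    SumsTo (Gops w (Fop (-1) dl)) v := by
  have hneg : (-1 : ℝ) = 1 ∨ (-1 : ℝ) = -1 := Or.inr rfl
  have hg : Decay (Fop (-1) dl) := decay_Fop hneg decay_dl
  have hg0 : Fop (-1) dl 0 = 0 := by simp [Fop]
  have hgc := conv_Fop decay_dl
  obtain ⟨u, hu⟩ := conv_Gops w hg hgc
  set K : ℝ → ℝ := fun t => PS (Fop (-1) (Fs w)) t + Hf w (Fop (-1) dl) t with hK
  have hK0 : Tendsto K (𝓝[>] 0) (𝓝 u) := by
    have := (Fop_at0 (-1) hneg (decay_Fs hw)).add (Hf_at0 hw hg hgc hu)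
    rwa [zero_add] at this
  have hK1 : Tendsto K (𝓝[<] 1) (𝓝 v) := by
    have := (PS_abel hv).add (Hf_at1 hw hg hg0)
    rwa [add_zero] at this
  have hd : ∀ t ∈ Set.Ioo (0 : ℝ) 1, HasDerivAt K 0 t := by
    intro t ht
    have ht' : |t| < 1 := abs_lt.2 ⟨by linarith [ht.1], ht.2⟩
    have h1 := Fneg_deriv decay_dl ht.1 ht.2
    have h2 := (PS_Fop hneg (decay_Fs hw) ht').add (Hf_deriv hw hg hg0 ht.1 ht.2 h1)
    refine h2.congr_deriv ?_
    rw [PS_dl]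
    ring
  obtain ⟨a, ha⟩ := isOpen_Ioo.exists_is_const_of_deriv_eq_zero isPreconnected_Ioo
    (f := K) (s := Set.Ioo (0 : ℝ) 1)
    (fun t ht => (hd t ht).differentiableAt.differentiableWithinAt)
    (fun t ht => (hd t ht).deriv)
  have e0 : Tendsto K (𝓝[>] 0) (𝓝 a) := by
    refine tendsto_const_nhds.congr' ?_
    filter_upwards [Ioo_mem_nhdsGT (zero_lt_one' ℝ)] with t ht
    exact (ha t ht).symm
  have e1 : Tendsto K (𝓝[<] 1) (𝓝 a) := by
    refine tendsto_const_nhds.congr' ?_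
    filter_upwards [Ioo_mem_nhdsLT (zero_lt_one' ℝ)] with t ht
    exact (ha t ht).symm
  have : u = v := (tendsto_nhds_unique hK0 e0).trans (tendsto_nhds_unique e1 hK1)
  rwa [← this]

/-- Summands, grouped by the largest index, of the multiple sums. -/
noncomputable def Zf : (r : ℕ) → (Fin r → ℕ) → (Fin r → ℝ) → ℕ → ℝ
  | 0, _, _ => dl
  | r + 1, k, ε => fun n => ε (Fin.last r) ^ n / (n : ℝ) ^ k (Fin.last r) *
      ∑ m ∈ Finset.range n, Zf r (fun i => k i.castSucc) (fun i => ε i.castSucc) m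

lemma cmzv_succ (r : ℕ) (k : Fin (r + 1) → ℕ) (ε : Fin (r + 1) → ℂ) (M : ℕ) :
    cmzvPartial (r + 1) k ε M = ∑ n ∈ Finset.Icc 1 M,
      ε (Fin.last r) ^ n / (n : ℂ) ^ k (Fin.last r) *
        cmzvPartial r (fun i => k i.castSucc) (fun i => ε i.castSucc) (n - 1) := by
  simp only [cmzvPartial, Finset.mul_sum]
  rw [Finset.sum_sigma']
  refine Finset.sum_bij' (fun n _ => ⟨n (Fin.last r), fun i => n i.castSucc⟩)
    (fun p _ => (Fin.snoc p.2 p.1 : Fin (r + 1) → ℕ)) ?_ ?_ ?_ ?_ ?_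
  · intro n hn
    simp only [Finset.mem_filter, Fintype.mem_piFinset, Finset.mem_Icc, Finset.mem_sigma] at hn ⊢
    refine ⟨hn.1 _, fun i => ⟨(hn.1 _).1, ?_⟩, fun i j hij => hn.2 _ _ (by simpa using hij)⟩
    have := hn.2 i.castSucc (Fin.last r) (Fin.castSucc_lt_last i)
    omega
  · rintro ⟨a, f⟩ hp
    simp only [Finset.mem_filter, Fintype.mem_piFinset, Finset.mem_Icc, Finset.mem_sigma] at hp ⊢
    obtain ⟨ha, hf, hlt⟩ := hp
    constructor
    · intro i
      refine Fin.lastCases ?_ (fun i => ?_) i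
      · simpa using ha
      · have := hf i
        simp only [Fin.snoc_castSucc]
        omega
    · intro i j
      refine Fin.lastCases ?_ (fun j => ?_) j
      · refine Fin.lastCases ?_ (fun i => ?_) i
        · simp
        · intro _
          have := hf i
          simp only [Fin.snoc_castSucc, Fin.snoc_last]
          omega
      · refine Fin.lastCases ?_ (fun i => ?_) i
        · intro h
          exact absurd h (not_lt.2 (Fin.le_last _))
        · intro h
          simp only [Fin.snoc_castSucc]
          exact hlt i j (by simpa using h)
  · intro n _
    funext i
    refine Fin.lastCases ?_ (fun i => ?_) i <;> simp
  · rintro ⟨a, f⟩ _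
    simp
  · intro n _
    rw [Fin.prod_univ_castSucc, mul_comm]

lemma cmzv_eq (r : ℕ) (k : Fin r → ℕ) (ε : Fin r → ℝ) (M : ℕ) :
    cmzvPartial r k (fun i => (ε i : ℂ)) M = ((∑ m ∈ Finset.range (M + 1), Zf r k ε m : ℝ) : ℂ) := by
  induction r generalizing M with
  | zero =>
    rw [Finset.sum_range_succ']
    simp [cmzvPartial, Zf, dl]
  | succ r ih =>
    rw [cmzv_succ]
    simp only [ih]
    have h0 : Finset.Icc 1 M = (Finset.range M).map (addRightEmbedding 1) := by
      rw [Finset.range_eq_Ico, Finset.map_add_right_Ico, zero_add]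
      rfl
    rw [Finset.sum_range_succ', h0, Finset.sum_map]
    push_cast
    simp [Zf]

lemma lim_real {c : ℕ → ℝ} {z : ℂ}
    (h : Tendsto (fun M => ((∑ m ∈ Finset.range (M + 1), c m : ℝ) : ℂ)) atTop (𝓝 z)) :
    ∃ v : ℝ, z = v ∧ SumsTo c v := by
  have h1 : Tendsto (fun M => ∑ m ∈ Finset.range (M + 1), c m) atTop (𝓝 z.re) := by
    have := (Complex.continuous_re.tendsto z).comp h
    refine this.congr fun M => ?_
    simp only [Function.comp, Complex.ofReal_re]
  refine ⟨z.re, ?_, ?_⟩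
  · exact tendsto_nhds_unique h ((Complex.continuous_ofReal.tendsto _).comp h1)
  · rw [SumsTo, ← tendsto_add_atTop_iff_nat 1]
    exact h1

lemma signs_conv (r : ℕ) (ε : Fin r → ℝ) (hε : ∀ i, ε i = 1 ∨ ε i = -1) (σ : ℝ)
    (hσ : σ = 1 ∨ σ = -1) : ∃ w : List ℝ, Signs w ∧ w.length = r ∧
      ∀ n, Fs w n = σ ^ n * Zf r (fun _ => 1) ε n := by
  induction r generalizing σ with
  | zero =>
    refine ⟨[], by simp [Signs], rfl, fun n => ?_⟩
    by_cases h : n = 0 <;> simp [Fs, Zf, dl, h]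
  | succ r ih =>
    set τ := σ * ε (Fin.last r) with hτ
    have hτs : τ = 1 ∨ τ = -1 := by
      rcases hσ with h1 | h1 <;> rcases hε (Fin.last r) with h2 | h2 <;> simp [hτ, h1, h2]
    obtain ⟨w, hw, hl, h⟩ := ih (fun i => ε i.castSucc) (fun i => hε _) τ hτs
    refine ⟨τ :: w, ?_, by simp [hl], fun n => ?_⟩
    · intro x hx
      rcases List.mem_cons.1 hx with rfl | hx
      · exact hτs
      · exact hw x hx
    have hpp : ∀ m : ℕ, τ ^ m * τ ^ m = 1 := by
      intro m
      rw [← mul_pow]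
      rcases hτs with h1 | h1 <;> simp [h1]
    simp only [Fs, Fop, Zf, h, ← mul_assoc, hpp, one_mul, pow_one]
    rw [hτ, mul_pow]
    ring

/-- The sequence attached to `ζ(1,…,1; 1,…,1,-1)`, without the sign. -/
noncomputable def U (r : ℕ) : ℕ → ℝ := Zf r (fun _ => 1) (fun _ => 1)

def gens (r : ℕ) : Set (ℕ → ℝ) :=
  {c | ∃ (d : ℕ) (k : Fin (d + 1) → ℕ), d + 1 < r ∧ (∀ i, 1 ≤ k i) ∧ ∑ i, k i = r ∧
    c = Zf (d + 1) k (fun _ => 1)}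

noncomputable def S (r : ℕ) : Submodule ℚ (ℕ → ℝ) := Submodule.span ℚ (gens r)

noncomputable def BL : (ℕ → ℝ) →ₗ[ℚ] (ℕ → ℝ) where
  toFun := Bop
  map_add' c d := by
    funext n
    simp only [Bop, Pi.add_apply, Finset.sum_add_distrib, add_div]
  map_smul' q c := by
    funext n
    simp only [Bop, Pi.smul_apply, RingHom.id_apply, Rat.smul_def, ← Finset.mul_sum, mul_div_assoc]

noncomputable def EL : (ℕ → ℝ) →ₗ[ℚ] (ℕ → ℝ) where
  toFun := Eop
  map_add' c d := by
    funext n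
    simp only [Eop, Pi.add_apply, add_div]
  map_smul' q c := by
    funext n
    simp only [Eop, Pi.smul_apply, RingHom.id_apply, Rat.smul_def, mul_div_assoc]

lemma Bop_Zf (d : ℕ) (k : Fin d → ℕ) :
    Bop (Zf d k (fun _ => 1)) = Zf (d + 1) (Fin.snoc k 1 : Fin (d + 1) → ℕ) (fun _ => 1) := by
  funext n
  simp only [Zf, Bop, Fin.snoc_castSucc, Fin.snoc_last, one_pow, pow_one]
  ring

lemma Eop_Zf (d : ℕ) (k : Fin (d + 1) → ℕ) :
    Eop (Zf (d + 1) k (fun _ => 1)) =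
      Zf (d + 1) (Fin.snoc (fun i => k i.castSucc) (k (Fin.last d) + 1) : Fin (d + 1) → ℕ)
        (fun _ => 1) := by
  funext n
  simp only [Zf, Eop, Fin.snoc_castSucc, Fin.snoc_last, one_pow, pow_succ]
  ring

lemma snoc_ones (d : ℕ) : (Fin.snoc (fun _ : Fin d => 1) 1 : Fin (d + 1) → ℕ) = fun _ => 1 := by
  funext i
  refine Fin.lastCases ?_ (fun i => ?_) i <;> simp

lemma Bop_U (r : ℕ) : Bop (U r) = U (r + 1) := by
  rw [U, Bop_Zf, snoc_ones, U]

lemma B_S {r : ℕ} {c : ℕ → ℝ} (hc : c ∈ S r) : Bop c ∈ S (r + 1) := by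
  have : S r ≤ (S (r + 1)).comap BL := by
    refine Submodule.span_le.2 ?_
    rintro _ ⟨d, k, h1, h2, h3, rfl⟩
    refine Submodule.subset_span ⟨d + 1, Fin.snoc k 1, by omega, ?_, ?_, Bop_Zf _ _⟩
    · intro i
      refine Fin.lastCases ?_ (fun i => ?_) i
      · simp
      · simpa using h2 i
    · rw [Fin.sum_univ_castSucc]
      simp [h3]
  exact this hc

lemma E_gen {r d : ℕ} {k : Fin (d + 1) → ℕ} (h1 : d + 1 ≤ r) (h2 : ∀ i, 1 ≤ k i)
    (h3 : ∑ i, k i = r) : Eop (Zf (d + 1) k (fun _ => 1)) ∈ S (r + 1) := by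
  refine Submodule.subset_span ⟨d, _, by omega, ?_, ?_, Eop_Zf d k⟩
  · intro i
    refine Fin.lastCases ?_ (fun i => ?_) i
    · simp
    · simpa using h2 _
  · rw [Fin.sum_univ_castSucc] at h3 ⊢
    simp only [Fin.snoc_castSucc, Fin.snoc_last]
    omega

lemma E_S {r : ℕ} {c : ℕ → ℝ} (hc : c ∈ S r) : Eop c ∈ S (r + 1) := by
  have : S r ≤ (S (r + 1)).comap EL := by
    refine Submodule.span_le.2 ?_
    rintro _ ⟨d, k, h1, h2, h3, rfl⟩
    exact E_gen h1.le h2 h3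
  exact this hc

lemma E_U (r : ℕ) : Eop (U (r + 1)) ∈ S (r + 1 + 1) :=
  E_gen le_rfl (fun _ => le_rfl) (by simp)

/-- Sign twist. -/
noncomputable def tw (c : ℕ → ℝ) : ℕ → ℝ := fun n => (-1) ^ n * c n

lemma tw_tw (c : ℕ → ℝ) : tw (tw c) = c := by
  funext n
  simp only [tw, ← mul_assoc, ← mul_pow]
  simp

lemma tw_Gop (η : ℝ) (g : ℕ → ℝ) :
    tw (Gop η g) = if η = 1 then Eop (tw g) + Bop (tw g) else Bop (tw g) := by
  have hF : tw (Fop (-1) g) = Bop (tw g) := by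
    have : Fop (-1) g = tw (Bop (tw g)) := funext (Fop_neg g)
    rw [this, tw_tw]
  rw [Gop]
  split_ifs
  · rw [← hF]
    funext n
    simp only [tw, Eop, Pi.add_apply]
    ring
  · exact hF

lemma Gops_mem (w : List ℝ) (r : ℕ) (g : ℕ → ℝ) (hg : tw g - U (r + 1) ∈ S (r + 1)) :
    tw (Gops w g) - U (w.length + r + 1) ∈ S (w.length + r + 1) := by
  induction w generalizing r g with
  | nil => simpa [Gops] using hg
  | cons η w ih =>
    have hB : Bop (tw g) - U (r + 1 + 1) ∈ S (r + 1 + 1) := by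
      rw [← Bop_U]
      have := B_S hg
      rwa [show Bop (tw g - U (r + 1)) = Bop (tw g) - Bop (U (r + 1)) from map_sub BL _ _] at this
    have hE : Eop (tw g) ∈ S (r + 1 + 1) := by
      have := E_S hg
      rw [show Eop (tw g - U (r + 1)) = Eop (tw g) - Eop (U (r + 1)) from map_sub EL _ _] at this
      simpa using Submodule.add_mem _ this (E_U r)
    have key : tw (Gop η g) - U (r + 1 + 1) ∈ S (r + 1 + 1) := by
      rw [tw_Gop]
      split_ifs
      · rw [add_sub_assoc]
        exact Submodule.add_mem _ hE hB
      · exact hB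
    have := ih (r + 1) (Gop η g) key
    rw [List.length_cons, show w.length + 1 + r + 1 = w.length + (r + 1) + 1 by omega]
    exact this

lemma decay_Zf (d : ℕ) (k : Fin d → ℕ) (hk : ∀ i, 1 ≤ k i) : Decay (Zf d k (fun _ => 1)) := by
  induction d with
  | zero => exact decay_dl
  | succ d ih =>
    refine decay_avg (ih (fun i => k i.castSucc) fun i => hk _) fun n => ?_
    rcases Nat.eq_zero_or_pos n with h0 | h0
    · subst h0; simp [Zf]
    have hn : (1 : ℝ) ≤ n := by exact_mod_cast h0
    simp only [Zf, one_pow, one_div, abs_mul, abs_inv, abs_pow, Nat.abs_cast]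
    rw [inv_mul_eq_div]
    gcongr
    · exact Finset.abs_sum_le_sum_abs _ _
    · exact le_self_pow₀ hn (by have := hk (Fin.last d); omega)

lemma conv_Zf (d : ℕ) (k : Fin (d + 1) → ℕ) (hk : ∀ i, 1 ≤ k i) :
    ∃ v, SumsTo (tw (Zf (d + 1) k (fun _ => 1))) v := by
  have hks : k = Fin.snoc (fun i => k i.castSucc) (k (Fin.last d)) := by
    funext i
    refine Fin.lastCases ?_ (fun i => ?_) i <;> simp
  obtain ⟨j, hj⟩ : ∃ j, k (Fin.last d) = j + 1 := ⟨k (Fin.last d) - 1, by have := hk (Fin.last d); omega⟩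
  rcases Nat.eq_zero_or_pos j with h0 | h0
  · rw [hks, hj, h0, zero_add, ← Bop_Zf]
    exact conv_Bop (decay_Zf d _ fun i => hk _)
  · have := Eop_Zf d (Fin.snoc (fun i => k i.castSucc) j)
    simp only [Fin.snoc_castSucc, Fin.snoc_last] at this
    rw [hks, hj, ← this]
    obtain ⟨v, hv⟩ := conv_Eop (decay_tw (decay_Zf (d + 1) (Fin.snoc (fun i => k i.castSucc) j) (by
      intro i
      refine Fin.lastCases ?_ (fun i => ?_) i
      · rw [Fin.snoc_last]; exact h0
      · simpa using hk _)))
    refine ⟨v, ?_⟩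
    convert hv using 1
    funext n
    simp only [tw, Eop]
    ring

lemma Zf_last (d : ℕ) (k : Fin (d + 1) → ℕ) :
    Zf (d + 1) k (fun i => if (i : ℕ) = d then -1 else 1) = tw (Zf (d + 1) k (fun _ => 1)) := by
  funext n
  have : ∀ i : Fin d, ((i : ℕ) = d) = False := fun i => by simp [i.2.ne]
  simp only [Zf, tw, Fin.val_last, if_true, Fin.val_castSucc, this, if_false, one_pow]
  ring

lemma cast_sign (d : ℕ) : (fun i : Fin (d + 1) => if (i : ℕ) = d then (-1 : ℂ) else 1) =
    fun i : Fin (d + 1) => (((if (i : ℕ) = d then (-1 : ℝ) else 1) : ℝ) : ℂ) := by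
  funext i
  split_ifs <;> simp

lemma S_eval (r : ℕ) (c : ℕ → ℝ) (hc : c ∈ S (r + 1)) :
    ∃ v : ℝ, SumsTo (tw c) v ∧ (v : ℂ) ∈ depthFilteredCMZV 2 (r + 1) r := by
  induction hc using Submodule.span_induction with
  | mem c hc =>
    obtain ⟨d, k, h1, h2, h3, rfl⟩ := hc
    obtain ⟨v, hv⟩ := conv_Zf d k h2
    refine ⟨v, hv, Submodule.subset_span ⟨d + 1, by omega, by omega, k,
      fun i => if (i : ℕ) = d then (-1 : ℂ) else 1, h2, ?_, ?_, h3, ?_⟩⟩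
    · intro i
      dsimp only
      split_ifs <;> simp
    · rintro ⟨-, h⟩
      simp at h
      norm_num at h
    · have e : cmzvPartial (d + 1) k (fun i => if (i : ℕ) = d then (-1 : ℂ) else 1) =
          fun M => ((∑ m ∈ Finset.range (M + 1), tw (Zf (d + 1) k (fun _ => 1)) m : ℝ) : ℂ) := by
        funext M
        rw [cast_sign, cmzv_eq, Zf_last]
      rw [e]
      exact (Complex.continuous_ofReal.tendsto v).comp ((tendsto_add_atTop_iff_nat 1).2 hv)
  | zero =>
    refine ⟨0, ?_, by simp⟩
    simp [SumsTo, tw]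
  | add c d _ _ hc hd =>
    obtain ⟨u, hu, hu'⟩ := hc
    obtain ⟨v, hv, hv'⟩ := hd
    refine ⟨u + v, ?_, ?_⟩
    · convert hu.add hv using 1
      funext n
      simp only [tw, Pi.add_apply]
      ring
    · push_cast
      exact Submodule.add_mem _ hu' hv'
  | smul q c _ hc =>
    obtain ⟨u, hu, hu'⟩ := hc
    refine ⟨q * u, ?_, ?_⟩
    · refine (Tendsto.const_mul (q : ℝ) hu).congr fun N => ?_
      rw [Finset.mul_sum]
      refine Finset.sum_congr rfl fun n _ => ?_
      simp only [tw, Pi.smul_apply, Rat.smul_def]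
      ring
    · have := Submodule.smul_mem _ q hu'
      rw [Rat.smul_def] at this
      push_cast
      exact this

end UnitCMZV

open UnitCMZV in
/-- Theorem 1.1(i), `N = 2`: any weight-`r` depth-`r` unit value `ζ(1,…,1; ε₁,…,ε_r)` with
`εᵢ ∈ {±1}`, `ε_r = -1`, equals a rational multiple of `ζ(1,…,1; 1,…,1,-1)` modulo
`D_{r-1} Z_r(2)`. -/
theorem unit_cmzv_depth_graded_mu2 (r : ℕ) (hr : 1 ≤ r)
    (ε : Fin r → ℂ) (hε : ∀ i, ε i = 1 ∨ ε i = -1)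
    (hlast : ε ⟨r - 1, by omega⟩ = -1)
    (z z₀ : ℂ)
    (hz : Tendsto (cmzvPartial r (fun _ => 1) ε) atTop (𝓝 z))
    (hz₀ : Tendsto
      (cmzvPartial r (fun _ => 1) (fun i => if (i : ℕ) = r - 1 then -1 else 1))
      atTop (𝓝 z₀)) :
    ∃ c : ℚ, z - (c : ℂ) * z₀ ∈ depthFilteredCMZV 2 r (r - 1) := by
  obtain ⟨r, rfl⟩ : ∃ s, r = s + 1 := ⟨r - 1, by omega⟩
  simp only [Nat.add_sub_cancel] at hlast hz₀ ⊢
  refine ⟨1, ?_⟩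
  -- pass to real signs
  obtain ⟨δ, rfl⟩ : ∃ δ : Fin (r + 1) → ℝ, ε = fun i => (δ i : ℂ) := by
    refine ⟨fun i => (ε i).re, funext fun i => ?_⟩
    rcases hε i with h | h <;> simp [h]
  have hδ : ∀ i, δ i = 1 ∨ δ i = -1 := by
    intro i
    have hi : ((δ i : ℝ) : ℂ) = 1 ∨ ((δ i : ℝ) : ℂ) = -1 := hε i
    rcases hi with h | h
    · left; exact_mod_cast h
    · right; exact_mod_cast h
  have hδl : δ (Fin.last r) = -1 := by
    have : ((δ (Fin.last r) : ℝ) : ℂ) = -1 := hlast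
    exact_mod_cast this
  rw [funext (cmzv_eq _ _ _)] at hz
  obtain ⟨v, rfl, hv⟩ := lim_real hz
  rw [cast_sign, funext (cmzv_eq _ _ _), Zf_last] at hz₀
  obtain ⟨u, rfl, hu⟩ := lim_real hz₀
  obtain ⟨w, hw, hl, h⟩ := signs_conv r (fun i => δ i.castSucc) (fun i => hδ _) (-1) (Or.inr rfl)
  have e : Zf (r + 1) (fun _ => 1) δ = Fop (-1) (Fs w) := by
    funext n
    have hpp : ∀ m : ℕ, (-1 : ℝ) ^ m * (-1) ^ m = 1 := by
      intro m
      rw [← mul_pow]; simp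
    simp only [Fop, Zf, h, ← mul_assoc, hpp, one_mul, pow_one, hδl]
    ring
  rw [e] at hv
  have hd := duality hw hv
  have hbase : tw (Fop (-1) dl) - U (0 + 1) ∈ S (0 + 1) := by
    have h1 : tw (Fop (-1) dl) = Bop (tw dl) := by
      have : Fop (-1) dl = tw (Bop (tw dl)) := funext (Fop_neg dl)
      rw [this, tw_tw]
    have h2 : tw dl = U 0 := by
      funext n
      by_cases h : n = 0 <;> simp [tw, U, Zf, dl, h]
    rw [h1, h2, Bop_U]
    simp
  have hm := Gops_mem w 0 _ hbase
  rw [hl, add_zero] at hm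
  obtain ⟨x, hx, hx'⟩ := S_eval r _ hm
  have hxu := hx.add hu
  have e2 : tw (tw (Gops w (Fop (-1) dl)) - U (r + 1)) +
      tw (Zf (r + 1) (fun _ => 1) (fun _ => 1)) = Gops w (Fop (-1) dl) := by
    conv_rhs => rw [← tw_tw (Gops w (Fop (-1) dl))]
    funext n
    simp only [tw, U, Pi.add_apply, Pi.sub_apply]
    ring
  rw [e2] at hxu
  have : v = x + u := tendsto_nhds_unique hd hxu
  rw [this]
  push_cast
  simpa using hx'
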